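/- arXiv:2101.04182 — 3 statements merged into one kernel-verified Lean document; each statement's English description precedes it below -/
import Mathlib

section
/- Let A_1,…,A_m be real symmetric n×n matrices, b ∈ ℝ^m, θ ≥ 0, and ε ∈ (0,1). Suppose ŷ ∈ ℝ^m and ν̂ ≥ 0 satisfy bᵀŷ − θν̂ = 1 and ∑_{i≤m} ŷ_i A_i − ν̂·I ⪯ 0 (a Farkas certificate of infeasibility of the original problem). Let T ∈ ℝ^{d×m} be a matrix satisfying ⟨Tb, Tŷ⟩ ≥ bᵀŷ − ε‖b‖₂‖ŷ‖₂ and ‖TᵀT ŷ − ŷ‖_∞ ≤ ε‖ŷ‖₂, and assume ε‖ŷ‖₂(‖b‖₂ + θ‖Aᵀ‖) < 1. Then the projected problem is infeasible: there is no real symmetric n×n matrix x with x ⪰ 0, tr(x) ≤ θ, and ∑_{i≤m} T_{ki}·tr(A_i x) = (Tb)_k for all k ≤ d. -/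
open MeasureTheory Pointwise

/-- Euclidean (ℓ2) norm of a vector in ℝ^k. -/
noncomputable def norm2 {k : ℕ} (x : Fin k → ℝ) : ℝ := Real.sqrt (∑ i, (x i) ^ 2)

/-- Supremum (ℓ∞) norm of a vector in ℝ^k. -/
noncomputable def normInf {k : ℕ} (x : Fin k → ℝ) : ℝ := ⨆ i, |x i|

/-- Standard Euclidean inner product on ℝ^k. -/
def dotp {k : ℕ} (x y : Fin k → ℝ) : ℝ := ∑ i, x i * y i

/-- ℓ2 operator (spectral) norm of a matrix. -/
noncomputable def specNorm {p q : ℕ} (M : Matrix (Fin p) (Fin q) ℝ) : ℝ :=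
  ⨆ u : {u : Fin q → ℝ // norm2 u ≤ 1}, norm2 (M.mulVec u.1)

/-- ‖Aᵀ‖ := sup { ‖∑ i, y i • A i‖₂ : ‖y‖_∞ ≤ 1 }. -/
noncomputable def ATnorm {n m : ℕ} (A : Fin m → Matrix (Fin n) (Fin n) ℝ) : ℝ :=
  ⨆ y : {y : Fin m → ℝ // normInf y ≤ 1}, specNorm (∑ i, y.1 i • A i)

/-- Smallest eigenvalue of a real symmetric matrix, via the Rayleigh quotient. -/
noncomputable def lambdaMin {n : ℕ} (M : Matrix (Fin n) (Fin n) ℝ) : ℝ :=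
  ⨅ u : {u : Fin n → ℝ // u ≠ 0}, dotp u.1 (M.mulVec u.1) / (∑ i, (u.1 i) ^ 2)

/-- Largest eigenvalue of a real symmetric matrix, via the Rayleigh quotient. -/
noncomputable def lambdaMax {n : ℕ} (M : Matrix (Fin n) (Fin n) ℝ) : ℝ :=
  ⨆ u : {u : Fin n → ℝ // u ≠ 0}, dotp u.1 (M.mulVec u.1) / (∑ i, (u.1 i) ^ 2)

/-- Loewner order: X ⪯ Y iff Y - X is positive semidefinite. -/
def PSDle {n : ℕ} (X Y : Matrix (Fin n) (Fin n) ℝ) : Prop := (Y - X).PosSemidef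

/-- Frobenius norm of a matrix. -/
noncomputable def frobNorm {n : ℕ} (X : Matrix (Fin n) (Fin n) ℝ) : ℝ :=
  Real.sqrt (∑ i, ∑ j, (X i j) ^ 2)

/-- A random matrix `T : Ω → ℝ^{d×m}` is a random projection with constants `c, C` if
for every `ε ∈ (0,1)` and `x ∈ ℝ^m`, `(1-ε)‖x‖² ≤ ‖Tx‖² ≤ (1+ε)‖x‖²` holds with
probability at least `1 - c·exp(-C ε² d)`. -/
def IsRandomProjection {Ω : Type*} [MeasurableSpace Ω] (μ : Measure Ω) {d m : ℕ}
    (T : Ω → Matrix (Fin d) (Fin m) ℝ) (c C : ℝ) : Prop :=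
  ∀ ε ∈ Set.Ioo (0 : ℝ) 1, ∀ x : Fin m → ℝ,
    1 - c * Real.exp (-C * ε ^ 2 * d) ≤
      (μ {ω | (1 - ε) * (norm2 x) ^ 2 ≤ (norm2 ((T ω).mulVec x)) ^ 2 ∧
              (norm2 ((T ω).mulVec x)) ^ 2 ≤ (1 + ε) * (norm2 x) ^ 2}).toReal

/-- Gaussian width of a set `S ⊆ ℝ^k`. -/
noncomputable def gaussWidth {k : ℕ} (S : Set (Fin k → ℝ)) : ℝ :=
  ∫ g, (⨆ x : S, dotp g x.1) ∂(Measure.pi fun _ : Fin k => ProbabilityTheory.gaussianReal 0 1)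

/-- Radius (w.r.t. the Euclidean norm) of a set `S ⊆ ℝ^k`. -/
noncomputable def rad2 {k : ℕ} (S : Set (Fin k → ℝ)) : ℝ := ⨆ x : S, norm2 x.1

/-- Diameter (w.r.t. the Euclidean norm) of a set `S ⊆ ℝ^k`. -/
noncomputable def diam2 {k : ℕ} (S : Set (Fin k → ℝ)) : ℝ :=
  ⨆ p : ↥(S ×ˢ S), norm2 (p.1.1 - p.1.2)

lemma trace_le_of_quad {n : ℕ} (M x : Matrix (Fin n) (Fin n) ℝ) (c : ℝ) (hx : x.PosSemidef)
    (h : ∀ u : Fin n → ℝ, dotp u (M.mulVec u) ≤ c * ∑ i, u i ^ 2) :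
    (M * x).trace ≤ c * x.trace := by
  obtain ⟨k, v, rfl⟩ := Matrix.posSemidef_iff_eq_sum_vecMulVec.mp hx
  rw [Finset.mul_sum, Matrix.trace_sum, Matrix.trace_sum, Finset.mul_sum]
  refine Finset.sum_le_sum fun i _ => ?_
  have := h (v i)
  rw [Matrix.mul_vecMulVec, Matrix.trace_vecMulVec, Matrix.trace_vecMulVec]
  simp only [dotp] at this
  simp only [dotProduct, star_trivial]
  calc _ = ∑ j, v i j * (M.mulVec (v i)) j := Finset.sum_congr rfl fun _ _ => mul_comm _ _
    _ ≤ _ := this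
    _ = _ := by simp only [sq]

lemma norm2_nonneg' {k : ℕ} (x : Fin k → ℝ) : 0 ≤ norm2 x := Real.sqrt_nonneg _

lemma norm2_sq {k : ℕ} (x : Fin k → ℝ) : norm2 x ^ 2 = ∑ i, x i ^ 2 :=
  Real.sq_sqrt (Finset.sum_nonneg fun _ _ => sq_nonneg _)

lemma dotp_le {k : ℕ} (x y : Fin k → ℝ) : dotp x y ≤ norm2 x * norm2 y :=
  Real.sum_mul_le_sqrt_mul_sqrt _ _ _

lemma norm2_smul' {k : ℕ} (c : ℝ) (x : Fin k → ℝ) : norm2 (c • x) = |c| * norm2 x := by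
  simp only [norm2, Pi.smul_apply, smul_eq_mul, mul_pow, ← Finset.mul_sum]
  rw [Real.sqrt_mul (sq_nonneg c), Real.sqrt_sq_eq_abs]

lemma norm2_mulVec_le {p q : ℕ} (M : Matrix (Fin p) (Fin q) ℝ) (u : Fin q → ℝ) :
    norm2 (M.mulVec u) ≤ Real.sqrt (∑ i, ∑ j, (M i j) ^ 2) * norm2 u := by
  unfold norm2
  have h0 : 0 ≤ ∑ i, ∑ j, (M i j) ^ 2 :=
    Finset.sum_nonneg fun _ _ => Finset.sum_nonneg fun _ _ => sq_nonneg _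
  refine le_of_le_of_eq ?_ (Real.sqrt_mul h0 _)
  apply Real.sqrt_le_sqrt
  rw [Finset.sum_mul]
  exact Finset.sum_le_sum fun i _ => 
    Finset.sum_mul_sq_le_sq_mul_sq Finset.univ (fun j => M i j) u

lemma spec_bdd {p q : ℕ} (M : Matrix (Fin p) (Fin q) ℝ) :
    BddAbove (Set.range fun u : {u : Fin q → ℝ // norm2 u ≤ 1} => norm2 (M.mulVec u.1)) := by
  refine ⟨Real.sqrt (∑ i, ∑ j, (M i j) ^ 2), ?_⟩
  rintro _ ⟨u, rfl⟩
  exact (norm2_mulVec_le M u.1).trans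
    (mul_le_of_le_one_right (Real.sqrt_nonneg _) u.2)

lemma specNorm_le {p q : ℕ} (M : Matrix (Fin p) (Fin q) ℝ) :
    specNorm M ≤ Real.sqrt (∑ i, ∑ j, (M i j) ^ 2) := by
  haveI : Nonempty {u : Fin q → ℝ // norm2 u ≤ 1} := ⟨⟨0, by simp [norm2]⟩⟩
  exact ciSup_le fun u => (norm2_mulVec_le M u.1).trans
    (mul_le_of_le_one_right (Real.sqrt_nonneg _) u.2)

lemma le_specNorm {p q : ℕ} (M : Matrix (Fin p) (Fin q) ℝ) (u : Fin q → ℝ) :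
    norm2 (M.mulVec u) ≤ specNorm M * norm2 u := by
  rcases (norm2_nonneg' u).eq_or_lt with h | h
  · have := norm2_mulVec_le M u
    rw [← h] at this ⊢
    simpa using this
  · have h1 : norm2 ((norm2 u)⁻¹ • u) ≤ 1 := by
      rw [norm2_smul', abs_of_pos (inv_pos.2 h), inv_mul_cancel₀ h.ne']
    have h2 := le_ciSup (spec_bdd M) ⟨_, h1⟩
    change norm2 (M.mulVec ((norm2 u)⁻¹ • u)) ≤ specNorm M at h2
    rw [Matrix.mulVec_smul, norm2_smul', abs_of_pos (inv_pos.2 h)] at h2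
    rw [← div_le_iff₀ h, div_eq_inv_mul]
    exact h2

lemma abs_le_normInf {k : ℕ} (y : Fin k → ℝ) (i : Fin k) : |y i| ≤ normInf y :=
  le_ciSup (f := fun i => |y i|) (Set.finite_range _).bddAbove i

lemma le_ATnorm {n m : ℕ} (A : Fin m → Matrix (Fin n) (Fin n) ℝ) (y : Fin m → ℝ)
    (hy : normInf y ≤ 1) : specNorm (∑ i, y i • A i) ≤ ATnorm A := by
  refine le_ciSup (f := fun y : {y : Fin m → ℝ // normInf y ≤ 1} => specNorm (∑ i, y.1 i • A i))
    ?_ ⟨y, hy⟩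
  refine ⟨Real.sqrt (∑ j, ∑ k, (∑ i, |A i j k|) ^ 2), ?_⟩
  rintro _ ⟨y, rfl⟩
  refine (specNorm_le _).trans (Real.sqrt_le_sqrt ?_)
  refine Finset.sum_le_sum fun j _ => Finset.sum_le_sum fun k _ => ?_
  refine sq_le_sq' ?_ ?_ <;> rw [Matrix.sum_apply]
  · rw [← Finset.sum_neg_distrib]
    refine Finset.sum_le_sum fun i _ => ?_
    have := (abs_le_normInf y.1 i).trans y.2
    refine (abs_le.1 ?_).1
    rw [Matrix.smul_apply, smul_eq_mul, abs_mul]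
    exact mul_le_of_le_one_left (abs_nonneg _) this
  · refine Finset.sum_le_sum fun i _ => ?_
    have := (abs_le_normInf y.1 i).trans y.2
    refine (abs_le.1 ?_).2
    rw [Matrix.smul_apply, smul_eq_mul, abs_mul]
    exact mul_le_of_le_one_left (abs_nonneg _) this

lemma specNorm_nonneg' {p q : ℕ} (M : Matrix (Fin p) (Fin q) ℝ) : 0 ≤ specNorm M :=
  Real.iSup_nonneg fun _ => norm2_nonneg' _

lemma dotp_trace {n m : ℕ} (A : Fin m → Matrix (Fin n) (Fin n) ℝ) (x : Matrix (Fin n) (Fin n) ℝ)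
    (y : Fin m → ℝ) : ((∑ i, y i • A i) * x).trace = dotp (fun i => (A i * x).trace) y := by
  simp [dotp, Finset.sum_mul, Matrix.trace_sum, mul_comm]

/-- Given a Farkas certificate (ŷ, ν̂) of infeasibility of the original problem
and a matrix T with the stated scalar-product and ℓ∞ approximation properties, if
ε‖ŷ‖₂(‖b‖₂ + θ‖Aᵀ‖) < 1 then the projected problem is infeasible. -/
theorem stmt_3 {n m d : ℕ} (A : Fin m → Matrix (Fin n) (Fin n) ℝ)
    (hA : ∀ i, (A i).IsSymm) (b : Fin m → ℝ) (θ : ℝ) (hθ : 0 ≤ θ)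
    (ε : ℝ) (hε : ε ∈ Set.Ioo (0 : ℝ) 1)
    (yh : Fin m → ℝ) (νh : ℝ) (hνh : 0 ≤ νh)
    (hfarkas1 : dotp b yh - θ * νh = 1)
    (hfarkas2 : PSDle (∑ i, yh i • A i - νh • (1 : Matrix (Fin n) (Fin n) ℝ)) 0)
    (T : Matrix (Fin d) (Fin m) ℝ)
    (hT1 : dotp b yh - ε * norm2 b * norm2 yh ≤ dotp (T.mulVec b) (T.mulVec yh))
    (hT2 : normInf (T.transpose.mulVec (T.mulVec yh) - yh) ≤ ε * norm2 yh)
    (hsmall : ε * norm2 yh * (norm2 b + θ * ATnorm A) < 1) :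
    ¬ ∃ x : Matrix (Fin n) (Fin n) ℝ, x.PosSemidef ∧ x.trace ≤ θ ∧
        ∀ k : Fin d, ∑ i, T k i * (A i * x).trace = T.mulVec b k := by
  rintro ⟨x, hx, htr, hk⟩
  set z : Fin m → ℝ := fun i => (A i * x).trace with hz
  set e : Fin m → ℝ := T.transpose.mulVec (T.mulVec yh) - yh with he
  have hTz : T.mulVec z = T.mulVec b := funext hk
  have htr0 : 0 ≤ x.trace := hx.trace_nonneg
  have hδ : 0 < ε * norm2 yh := by
    refine mul_pos hε.1 ((norm2_nonneg' yh).lt_of_ne' fun h0 => ?_)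
    have h1 := dotp_le b yh
    rw [h0] at h1
    nlinarith [mul_nonneg hθ hνh]
  have key : dotp (T.mulVec b) (T.mulVec yh) = dotp z yh + dotp z e := by
    have h1 : dotp z yh + dotp z e = z ⬝ᵥ (T.transpose.mulVec (T.mulVec yh)) := by
      simp only [dotp, he, dotProduct, ← Finset.sum_add_distrib]
      refine Finset.sum_congr rfl fun i _ => ?_
      simp only [Pi.sub_apply]; ring
    rw [h1, Matrix.dotProduct_mulVec, Matrix.vecMul_transpose, hTz]
    rfl
  have hfirst : dotp z yh ≤ νh * x.trace := by
    rw [hz, ← dotp_trace]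
    refine trace_le_of_quad _ _ _ hx fun u => ?_
    have := (Matrix.posSemidef_iff_dotProduct_mulVec.1 hfarkas2).2 u
    rw [zero_sub, neg_sub, Matrix.sub_mulVec, Matrix.smul_mulVec, Matrix.one_mulVec,
      dotProduct_sub, dotProduct_smul, star_trivial] at this
    have h2 : u ⬝ᵥ u = ∑ i, u i ^ 2 := by simp [dotProduct, sq]
    rw [h2, smul_eq_mul] at this
    exact sub_nonneg.1 this
  have hAT : 0 ≤ ATnorm A := Real.iSup_nonneg fun _ => specNorm_nonneg' _
  have hsecond : dotp z e ≤ ε * norm2 yh * (ATnorm A * x.trace) := by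
    have hn : normInf ((ε * norm2 yh)⁻¹ • e) ≤ 1 := by
      refine Real.iSup_le (fun i => ?_) zero_le_one
      rw [Pi.smul_apply, smul_eq_mul, abs_mul, abs_of_pos (inv_pos.2 hδ), inv_mul_le_iff₀ hδ,
        mul_one]
      exact (abs_le_normInf e i).trans hT2
    have h1 := le_ATnorm A _ hn
    have h2 : dotp z ((ε * norm2 yh)⁻¹ • e) ≤ ATnorm A * x.trace := by
      rw [hz, ← dotp_trace]
      refine trace_le_of_quad _ _ _ hx fun u => ?_
      rw [← norm2_sq]
      refine (dotp_le _ _).trans ?_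
      have h3 := le_specNorm (∑ i, ((ε * norm2 yh)⁻¹ • e) i • A i) u
      have h4 := h3.trans (mul_le_mul_of_nonneg_right h1 (norm2_nonneg' u))
      calc _ ≤ norm2 u * (ATnorm A * norm2 u) := mul_le_mul_of_nonneg_left h4 (norm2_nonneg' u)
        _ = _ := by ring
    have h5 : dotp z ((ε * norm2 yh)⁻¹ • e) = (ε * norm2 yh)⁻¹ * dotp z e := by
      simp only [dotp, Pi.smul_apply, smul_eq_mul, Finset.mul_sum]
      exact Finset.sum_congr rfl fun i _ => by ring
    rwa [h5, inv_mul_le_iff₀ hδ] at h2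
  have h6 : νh * x.trace ≤ νh * θ := mul_le_mul_of_nonneg_left htr hνh
  have h7 : ε * norm2 yh * (ATnorm A * x.trace) ≤ ε * norm2 yh * (ATnorm A * θ) :=
    mul_le_mul_of_nonneg_left (mul_le_mul_of_nonneg_left htr hAT) hδ.le
  nlinarith
end

section
/- Let A_1,…,A_m be real symmetric n×n matrices whose Gram matrix G ∈ ℝ^{m×m}, G_{ij} = tr(A_i A_j), is positive definite, let b ∈ ℝ^m, and let x_T be a real symmetric n×n matrix. Let x̃ := x_T + ∑_{i≤m} (G^{-1}(b − 𝒜x_T))_i A_i, where 𝒜x := (tr(A_i x))_{i≤m}. Then λ_min(x̃) ≥ λ_min(x_T) − ‖𝒜x_T − b‖₂ / √(λ_min(G)); in particular the negativity of the smallest eigenvalue of the retrieved solution x̃ is controlled by the equality-constraint infeasibility of x_T. -/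
open MeasureTheory Pointwise

lemma aux_frob_sq {n : ℕ} (M : Matrix (Fin n) (Fin n) ℝ) :
    frobNorm M ^ 2 = ∑ i, ∑ j, (M i j) ^ 2 :=
  Real.sq_sqrt (Finset.sum_nonneg fun i _ => Finset.sum_nonneg fun j _ => sq_nonneg _)

lemma aux_quad {n : ℕ} (M : Matrix (Fin n) (Fin n) ℝ) (u : Fin n → ℝ) :
    |dotp u (M.mulVec u)| ≤ frobNorm M * ∑ i, (u i) ^ 2 := by
  have hS : 0 ≤ ∑ i, (u i) ^ 2 := Finset.sum_nonneg fun i _ => sq_nonneg _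
  have h1 : dotp u (M.mulVec u) = ∑ p : Fin n × Fin n, M p.1 p.2 * (u p.1 * u p.2) := by
    rw [Fintype.sum_prod_type]
    simp only [dotp, Matrix.mulVec, dotProduct, Finset.mul_sum]
    exact Finset.sum_congr rfl fun i _ => Finset.sum_congr rfl fun j _ => by ring
  have h2 : ∑ p : Fin n × Fin n, (u p.1 * u p.2) ^ 2 = (∑ i, (u i) ^ 2) ^ 2 := by
    rw [Fintype.sum_prod_type, sq (∑ i, (u i) ^ 2), Finset.sum_mul_sum]
    exact Finset.sum_congr rfl fun i _ => Finset.sum_congr rfl fun j _ => by ring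
  have h3 := Finset.sum_mul_sq_le_sq_mul_sq Finset.univ
    (fun p : Fin n × Fin n => M p.1 p.2) (fun p => u p.1 * u p.2)
  have h4 : ∑ p : Fin n × Fin n, (M p.1 p.2) ^ 2 = frobNorm M ^ 2 := by
    rw [aux_frob_sq, Fintype.sum_prod_type]
  rw [h2, h4, ← h1, ← mul_pow] at h3
  exact abs_le_of_sq_le_sq h3 (mul_nonneg (Real.sqrt_nonneg _) hS)

lemma aux_sum_pos {n : ℕ} (u : Fin n → ℝ) (hu : u ≠ 0) : 0 < ∑ i, (u i) ^ 2 := by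
  obtain ⟨i, hi⟩ := Function.ne_iff.mp hu
  exact Finset.sum_pos' (fun i _ => sq_nonneg _) ⟨i, Finset.mem_univ _, by
    have : u i ≠ 0 := hi
    positivity⟩

lemma aux_lambda_le {n : ℕ} (M : Matrix (Fin n) (Fin n) ℝ) (u : Fin n → ℝ) :
    lambdaMin M * (∑ i, (u i) ^ 2) ≤ dotp u (M.mulVec u) := by
  by_cases hu : u = 0
  · subst hu
    simp [dotp]
  have hp := aux_sum_pos u hu
  rw [← le_div_iff₀ hp]
  refine ciInf_le (f := fun u : {u : Fin n → ℝ // u ≠ 0} =>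
    dotp u.1 (M.mulVec u.1) / (∑ i, (u.1 i) ^ 2)) ?_ ⟨u, hu⟩
  refine ⟨- frobNorm M, ?_⟩
  rintro _ ⟨v, rfl⟩
  have hv := aux_sum_pos v.1 v.2
  have := (abs_le.mp (aux_quad M v.1)).1
  simp only
  rw [le_div_iff₀ hv]
  linarith

lemma aux_lambda_pos {m : ℕ} (G : Matrix (Fin m) (Fin m) ℝ) (hG : G.PosDef)
    (w : Fin m → ℝ) (hw : w ≠ 0) : 0 < lambdaMin G := by
  let f : (Fin m → ℝ) → ℝ := fun u => dotp u (G.mulVec u) / (∑ i, (u i) ^ 2)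
  have hfpos : ∀ u, u ≠ 0 → 0 < f u := fun u hu => by
    refine div_pos ?_ (aux_sum_pos u hu)
    have := hG.dotProduct_mulVec_pos hu
    simpa [dotp, dotProduct] using this
  have hcont : ContinuousOn f (Metric.sphere 0 1) := by
    apply ContinuousOn.div
    · unfold dotp Matrix.mulVec dotProduct
      fun_prop
    · fun_prop
    · intro u hu
      exact (aux_sum_pos u (ne_zero_of_mem_unit_sphere ⟨u, hu⟩)).ne'
  have hscale : ∀ u : Fin m → ℝ, u ≠ 0 → ∃ v ∈ Metric.sphere (0 : Fin m → ℝ) 1, f v = f u := by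
    intro u hu
    have hn : ‖u‖ ≠ 0 := norm_ne_zero_iff.mpr hu
    refine ⟨‖u‖⁻¹ • u, by simp [norm_smul, hn], ?_⟩
    have hp := (aux_sum_pos u hu).ne'
    have e1 : ∑ i, ((‖u‖⁻¹ • u) i) ^ 2 = (‖u‖⁻¹) ^ 2 * ∑ i, (u i) ^ 2 := by
      rw [Finset.mul_sum]
      exact Finset.sum_congr rfl fun i _ => by simp [mul_pow]
    have e2 : dotp (‖u‖⁻¹ • u) (G.mulVec (‖u‖⁻¹ • u)) =
        (‖u‖⁻¹) ^ 2 * dotp u (G.mulVec u) := by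
      rw [Matrix.mulVec_smul, dotp, dotp, Finset.mul_sum]
      exact Finset.sum_congr rfl fun i _ => by simp only [Pi.smul_apply, smul_eq_mul]; ring
    simp only [f]
    rw [e1, e2, mul_div_mul_left]
    positivity
  obtain ⟨v0, hv0, -⟩ := hscale w hw
  obtain ⟨x, hx, hmin⟩ := (isCompact_sphere (0 : Fin m → ℝ) 1).exists_isMinOn ⟨v0, hv0⟩ hcont
  have hx0 : x ≠ 0 := ne_zero_of_mem_unit_sphere ⟨x, hx⟩
  have : Nonempty {u : Fin m → ℝ // u ≠ 0} := ⟨⟨w, hw⟩⟩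
  refine lt_of_lt_of_le (hfpos x hx0) (le_ciInf fun u => ?_)
  obtain ⟨v, hv, e⟩ := hscale u.1 u.2
  have : f x ≤ f v := hmin hv
  rw [e] at this
  exact this

lemma aux_frob {n m : ℕ} (A : Fin m → Matrix (Fin n) (Fin n) ℝ) (hA : ∀ i, (A i).IsSymm)
    (y : Fin m → ℝ) :
    frobNorm (∑ i, y i • A i) ^ 2 =
      dotp y ((Matrix.of fun i j => (A i * A j).trace).mulVec y) := by
  have hD : (∑ i, y i • A i).IsSymm := by
    simp only [Matrix.IsSymm, Matrix.transpose_sum, Matrix.transpose_smul]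
    exact Finset.sum_congr rfl fun i _ => by rw [hA i]
  have h1 : dotp y ((Matrix.of fun i j => (A i * A j).trace).mulVec y) =
      ((∑ i, y i • A i) * (∑ i, y i • A i)).trace := by
    rw [Finset.sum_mul_sum]
    simp only [dotp, Matrix.mulVec, dotProduct, Matrix.of_apply, Matrix.trace_sum, Finset.mul_sum, Matrix.smul_mul, Matrix.mul_smul, Matrix.trace_smul,
      smul_eq_mul]
    exact Finset.sum_congr rfl fun i _ => Finset.sum_congr rfl fun j _ => by ring
  rw [h1, aux_frob_sq]
  generalize (∑ i, y i • A i) = D at hD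
  simp only [Matrix.trace, Matrix.diag, Matrix.mul_apply]
  exact Finset.sum_congr rfl fun i _ => Finset.sum_congr rfl fun j _ => by
    rw [hD.apply i j, sq]

lemma aux_frob_le {n m : ℕ} (A : Fin m → Matrix (Fin n) (Fin n) ℝ) (hA : ∀ i, (A i).IsSymm)
    (G : Matrix (Fin m) (Fin m) ℝ) (hG : G = Matrix.of fun i j => (A i * A j).trace)
    (hGpd : G.PosDef) (s : Fin m → ℝ) :
    frobNorm (∑ i, (G⁻¹.mulVec s) i • A i) ≤ norm2 s / Real.sqrt (lambdaMin G) := by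
  have hF := aux_frob A hA (G⁻¹.mulVec s)
  rw [← hG] at hF
  have hdet : IsUnit G.det := hGpd.det_pos.ne'.isUnit
  have hGy : G.mulVec (G⁻¹.mulVec s) = s := by
    rw [Matrix.mulVec_mulVec, Matrix.mul_nonsing_inv _ hdet, Matrix.one_mulVec]
  have hl := aux_lambda_le G (G⁻¹.mulVec s)
  by_cases hs : s = 0
  · subst hs
    simp [frobNorm, norm2]
  have hpos := aux_lambda_pos G hGpd s hs
  rw [← hF] at hl
  rw [hGy] at hF
  generalize G⁻¹.mulVec s = y at *
  have hcs := Finset.sum_mul_sq_le_sq_mul_sq Finset.univ y s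
  have hs2 : norm2 s ^ 2 = ∑ i, (s i) ^ 2 :=
    Real.sq_sqrt (Finset.sum_nonneg fun i _ => sq_nonneg _)
  rw [← hs2] at hcs
  change (dotp y s) ^ 2 ≤ _ at hcs
  rw [← hF] at hcs
  have hF0 : 0 ≤ frobNorm (∑ i, y i • A i) := Real.sqrt_nonneg _
  have hN0 : 0 ≤ norm2 s := Real.sqrt_nonneg _
  generalize frobNorm (∑ i, y i • A i) = F at *
  generalize norm2 s = N at *
  generalize lambdaMin G = l at *
  rw [le_div_iff₀ (Real.sqrt_pos.mpr hpos)]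
  refine le_trans (le_abs_self _) (abs_le_of_sq_le_sq ?_ hN0)
  rw [mul_pow, Real.sq_sqrt hpos.le]
  rcases hF0.eq_or_lt with h | h
  · rw [← h]; simp; positivity
  · have hF2 : 0 < F ^ 2 := by positivity
    have : F ^ 2 * (F ^ 2 * l) ≤ F ^ 2 * N ^ 2 := by
      calc F ^ 2 * (F ^ 2 * l) = l * (F ^ 2) ^ 2 := by ring
        _ ≤ l * ((∑ i, y i ^ 2) * N ^ 2) := by gcongr
        _ = (l * ∑ i, y i ^ 2) * N ^ 2 := by ring
        _ ≤ F ^ 2 * N ^ 2 := by gcongr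
    exact le_of_mul_le_mul_left this hF2

/-- λ_min(x̃) ≥ λ_min(x_T) − ‖𝒜x_T − b‖₂ / √(λ_min(G)). -/
theorem stmt_16 {n m : ℕ} (A : Fin m → Matrix (Fin n) (Fin n) ℝ)
    (hA : ∀ i, (A i).IsSymm)
    (G : Matrix (Fin m) (Fin m) ℝ) (hG : G = Matrix.of fun i j => (A i * A j).trace)
    (hGpd : G.PosDef) (b : Fin m → ℝ)
    (xT : Matrix (Fin n) (Fin n) ℝ) (hxT : xT.IsSymm)
    (xtilde : Matrix (Fin n) (Fin n) ℝ)
    (hxtilde : xtilde = xT + ∑ i, (G⁻¹.mulVec (b - fun j => (A j * xT).trace)) i • A i) :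
    lambdaMin xT - norm2 ((fun i => (A i * xT).trace) - b) / Real.sqrt (lambdaMin G) ≤
      lambdaMin xtilde := by
  have hn : norm2 ((fun i => (A i * xT).trace) - b) =
      norm2 (b - fun j => (A j * xT).trace) := by
    unfold norm2
    congr 1
    exact Finset.sum_congr rfl fun i _ => by simp only [Pi.sub_apply]; ring
  rw [hn]
  have hD := aux_frob_le A hA G hG hGpd (b - fun j => (A j * xT).trace)
  generalize (∑ i, (G⁻¹.mulVec (b - fun j => (A j * xT).trace)) i • A i) = D at *
  generalize norm2 (b - fun j => (A j * xT).trace) / Real.sqrt (lambdaMin G) = c at *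
  have hc : 0 ≤ c := le_trans (Real.sqrt_nonneg _) hD
  rcases isEmpty_or_nonempty {u : Fin n → ℝ // u ≠ 0} with h | h
  · simp only [lambdaMin, Real.iInf_of_isEmpty]
    linarith
  · refine le_ciInf fun u => ?_
    have hu := aux_sum_pos u.1 u.2
    rw [le_div_iff₀ hu]
    have h1 := aux_lambda_le xT u.1
    have h2 := (abs_le.mp (aux_quad D u.1)).1
    have h3 : frobNorm D * ∑ i, (u.1 i) ^ 2 ≤ c * ∑ i, (u.1 i) ^ 2 := by gcongr
    have h4 : dotp u.1 (xtilde.mulVec u.1) =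
        dotp u.1 (xT.mulVec u.1) + dotp u.1 (D.mulVec u.1) := by
      rw [hxtilde, Matrix.add_mulVec]
      simp [dotp, mul_add, Finset.sum_add_distrib]
    rw [h4, sub_mul]
    linarith
end

section
/- Let A_1,…,A_m and c be real symmetric n×n matrices, with the Gram matrix G ∈ ℝ^{m×m}, G_{ij} = tr(A_i A_j), positive definite, let b ∈ ℝ^m, and let x_T be a real symmetric n×n matrix. Let x̃ := x_T + ∑_{i≤m} (G^{-1}(b − 𝒜x_T))_i A_i, where 𝒜x := (tr(A_i x))_{i≤m}. Then |tr(c·x̃) − tr(c·x_T)| ≤ ‖c‖_F · ‖𝒜x_T − b‖₂ / √(λ_min(G)). -/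
open MeasureTheory Pointwise

theorem aux_quad_s17 {m : ℕ} (G : Matrix (Fin m) (Fin m) ℝ) (hG : G.PosDef) (u : Fin m → ℝ)
    (hu : u ≠ 0) : 0 < dotp u (G.mulVec u) := by
  have h := hG.dotProduct_mulVec_pos hu
  simpa [dotp, dotProduct] using h

theorem aux_sq_pos {m : ℕ} (u : Fin m → ℝ) (hu : u ≠ 0) : 0 < ∑ i, (u i) ^ 2 := by
  obtain ⟨i, hi⟩ := Function.ne_iff.mp hu
  exact Finset.sum_pos' (fun j _ => sq_nonneg _) ⟨i, Finset.mem_univ _, by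
    have : u i ≠ 0 := hi
    positivity⟩

theorem aux_scale {m : ℕ} (G : Matrix (Fin m) (Fin m) ℝ) (u : Fin m → ℝ) (t : ℝ) (ht : t ≠ 0) :
    dotp (t • u) (G.mulVec (t • u)) / (∑ i, ((t • u) i) ^ 2) =
      dotp u (G.mulVec u) / (∑ i, (u i) ^ 2) := by
  have h1 : dotp (t • u) (G.mulVec (t • u)) = t ^ 2 * dotp u (G.mulVec u) := by
    simp only [dotp, Matrix.mulVec_smul, Pi.smul_apply, smul_eq_mul, Finset.mul_sum]
    refine Finset.sum_congr rfl fun i _ => by ring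
  have h2 : (∑ i, ((t • u) i) ^ 2) = t ^ 2 * ∑ i, (u i) ^ 2 := by
    simp only [Pi.smul_apply, smul_eq_mul, Finset.mul_sum]
    refine Finset.sum_congr rfl fun i _ => by ring
  rw [h1, h2, mul_div_mul_left _ _ (pow_ne_zero 2 ht)]

theorem aux_lam_pos {m : ℕ} (G : Matrix (Fin m) (Fin m) ℝ) (hG : G.PosDef) (z : Fin m → ℝ)
    (hz : z ≠ 0) : 0 < lambdaMin G := by
  have : Nonempty {u : Fin m → ℝ // u ≠ 0} := ⟨⟨z, hz⟩⟩
  have hne : (Metric.sphere (0 : Fin m → ℝ) 1).Nonempty :=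
    ⟨‖z‖⁻¹ • z, by
      have : ‖z‖ ≠ 0 := norm_ne_zero_iff.mpr hz
      simp [norm_smul, this]⟩
  have hs : ∀ u ∈ Metric.sphere (0 : Fin m → ℝ) 1, u ≠ 0 := by
    rintro u hu rfl
    simp at hu
  have hcont : ContinuousOn (fun u : Fin m → ℝ => dotp u (G.mulVec u) / (∑ i, (u i) ^ 2))
      (Metric.sphere 0 1) := by
    apply ContinuousOn.div
    · unfold dotp Matrix.mulVec dotProduct
      fun_prop
    · fun_prop
    · intro u hu
      exact (aux_sq_pos u (hs u hu)).ne'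
  obtain ⟨v, hv, hmin⟩ := (isCompact_sphere (0 : Fin m → ℝ) 1).exists_isMinOn hne hcont
  have hvpos := div_pos (aux_quad_s17 G hG v (hs v hv)) (aux_sq_pos v (hs v hv))
  refine lt_of_lt_of_le hvpos ?_
  unfold lambdaMin
  refine le_ciInf fun u => ?_
  have hn : ‖u.1‖ ≠ 0 := norm_ne_zero_iff.mpr u.2
  rw [← aux_scale G u.1 ‖u.1‖⁻¹ (inv_ne_zero hn)]
  exact hmin (by simp [norm_smul, hn])

theorem aux_lam_le {m : ℕ} (G : Matrix (Fin m) (Fin m) ℝ) (hG : G.PosDef) (z : Fin m → ℝ)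
    (hz : z ≠ 0) : lambdaMin G * (∑ i, (z i) ^ 2) ≤ dotp z (G.mulVec z) := by
  rw [← le_div_iff₀ (aux_sq_pos z hz)]
  unfold lambdaMin
  refine ciInf_le (f := fun u : {u : Fin m → ℝ // u ≠ 0} =>
    dotp u.1 (G.mulVec u.1) / (∑ i, (u.1 i) ^ 2)) ⟨0, ?_⟩ ⟨z, hz⟩
  rintro _ ⟨u, rfl⟩
  exact (div_pos (aux_quad_s17 G hG u.1 u.2) (aux_sq_pos u.1 u.2)).le

theorem aux_trace {n : ℕ} (c D : Matrix (Fin n) (Fin n) ℝ) (hD : D.IsSymm) :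
    (c * D).trace = ∑ p : Fin n × Fin n, c p.1 p.2 * D p.1 p.2 := by
  rw [Fintype.sum_prod_type]
  simp only [Matrix.trace, Matrix.diag, Matrix.mul_apply]
  refine Finset.sum_congr rfl fun i _ => Finset.sum_congr rfl fun j _ => ?_
  rw [hD.apply i j]

/-- |tr(c·x̃) − tr(c·x_T)| ≤ ‖c‖_F · ‖𝒜x_T − b‖₂ / √(λ_min(G)). -/
theorem stmt_17 {n m : ℕ} (A : Fin m → Matrix (Fin n) (Fin n) ℝ)
    (hA : ∀ i, (A i).IsSymm) (c : Matrix (Fin n) (Fin n) ℝ) (hc : c.IsSymm)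
    (G : Matrix (Fin m) (Fin m) ℝ) (hG : G = Matrix.of fun i j => (A i * A j).trace)
    (hGpd : G.PosDef) (b : Fin m → ℝ)
    (xT : Matrix (Fin n) (Fin n) ℝ) (hxT : xT.IsSymm)
    (xtilde : Matrix (Fin n) (Fin n) ℝ)
    (hxtilde : xtilde = xT + ∑ i, (G⁻¹.mulVec (b - fun j => (A j * xT).trace)) i • A i) :
    |(c * xtilde).trace - (c * xT).trace| ≤
      frobNorm c * norm2 ((fun i => (A i * xT).trace) - b) / Real.sqrt (lambdaMin G) := by
  set r : Fin m → ℝ := b - fun j => (A j * xT).trace with hr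
  set z : Fin m → ℝ := G⁻¹.mulVec r with hzdef
  set D : Matrix (Fin n) (Fin n) ℝ := ∑ i, z i • A i with hDdef
  have hDs : D.IsSymm := by
    rw [Matrix.IsSymm, hDdef, Matrix.transpose_sum]
    refine Finset.sum_congr rfl fun i _ => ?_
    rw [Matrix.transpose_smul, (hA i).eq]
  have hlhs : (c * xtilde).trace - (c * xT).trace = (c * D).trace := by
    rw [hxtilde, Matrix.mul_add, Matrix.trace_add]; ring
  have hnorm : norm2 ((fun i => (A i * xT).trace) - b) = norm2 r := by
    unfold norm2
    congr 1
    refine Finset.sum_congr rfl fun i _ => ?_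
    simp only [hr, Pi.sub_apply]; ring
  rw [hlhs, hnorm]
  by_cases hz : z = 0
  · have hD0 : D = 0 := by simp [hDdef, hz]
    rw [hD0]
    simp only [Matrix.mul_zero, Matrix.trace_zero, abs_zero]
    unfold frobNorm norm2
    positivity
  have hl := aux_lam_pos G hGpd z hz
  have hle := aux_lam_le G hGpd z hz
  have hGz : G.mulVec z = r := by
    rw [hzdef, Matrix.mulVec_mulVec, Matrix.mul_nonsing_inv _ hGpd.det_pos.ne'.isUnit,
      Matrix.one_mulVec]
  have hDD : (D * D).trace = dotp z (G.mulVec z) := by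
    simp only [hDdef, hG, dotp, Matrix.mulVec, dotProduct, Matrix.of_apply, Finset.sum_mul,
      Finset.mul_sum, Matrix.trace_sum, Matrix.smul_mul, Matrix.mul_smul, Matrix.trace_smul,
      smul_eq_mul]
    refine Finset.sum_congr rfl fun i _ => Finset.sum_congr rfl fun j _ => ?_
    rw [Matrix.trace_mul_comm (A j) (A i)]
    ring
  have hq : 0 < dotp z (G.mulVec z) := aux_quad_s17 G hGpd z hz
  have hcs : (dotp z r) ^ 2 ≤ (∑ i, (z i) ^ 2) * ∑ i, (r i) ^ 2 :=
    Finset.sum_mul_sq_le_sq_mul_sq _ _ _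
  rw [hGz] at hle hDD hq
  have hR : 0 ≤ ∑ i, (r i) ^ 2 := Finset.sum_nonneg fun i _ => sq_nonneg _
  have hq2 : dotp z r * lambdaMin G ≤ ∑ i, (r i) ^ 2 := by
    have h1 : dotp z r * (dotp z r * lambdaMin G) ≤ dotp z r * ∑ i, (r i) ^ 2 := by
      nlinarith [mul_le_mul_of_nonneg_right hle hR, mul_le_mul_of_nonneg_left hcs hl.le]
    exact le_of_mul_le_mul_left h1 hq
  have hcs2 : ((c * D).trace) ^ 2 ≤ (∑ i, ∑ j, (c i j) ^ 2) * (D * D).trace := by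
    rw [aux_trace c D hDs, aux_trace D D hDs]
    have := Finset.sum_mul_sq_le_sq_mul_sq Finset.univ
      (fun p : Fin n × Fin n => c p.1 p.2) (fun p => D p.1 p.2)
    rw [← Fintype.sum_prod_type (f := fun p : Fin n × Fin n => (c p.1 p.2) ^ 2)]
    simpa [sq] using this
  have hC : 0 ≤ ∑ i, ∑ j, (c i j) ^ 2 :=
    Finset.sum_nonneg fun i _ => Finset.sum_nonneg fun j _ => sq_nonneg _
  unfold frobNorm norm2
  rw [← Real.sqrt_mul hC, ← Real.sqrt_div (mul_nonneg hC hR)]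
  apply Real.abs_le_sqrt
  rw [le_div_iff₀ hl]
  rw [hDD] at hcs2
  nlinarith [mul_le_mul_of_nonneg_right hcs2 hl.le, mul_le_mul_of_nonneg_left hq2 hC]
end
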